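/- arXiv:2601.04146 — 2 statements merged into one kernel-verified Lean document; each statement's English description precedes it below -/
import Mathlib

section
/- Let X be a nonzero complex Banach space, let T be a bounded linear operator on X, and let Ω be a nonempty subset of ℂ with closure(Ω) ≠ ℂ. Then the Kreiss constant K_T(Ω) is finite if and only if the following two properties hold: σ(T) ⊆ closure(Ω), and there exist an open neighborhood U of closure(Ω) and a constant C ≥ 0 such that for every z ∈ U \ closure(Ω), the operator z − T is invertible and ‖(z − T)^{-1}‖ ≤ C / dist(z, Ω). -/
open Metric

noncomputable section

/-- The Kreiss constant of `T` with respect to `Ω` is finite: every `z ∉ closure Ω` lies in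
the resolvent set of `T`, and `dist(z, Ω) · ‖(z − T)⁻¹‖` is uniformly bounded there. -/
def KreissFinite {X : Type*} [NormedAddCommGroup X] [NormedSpace ℂ X] [CompleteSpace X]
    (T : X →L[ℂ] X) (Ω : Set ℂ) : Prop :=
  ∃ K : ℝ, ∀ z : ℂ, z ∉ closure Ω →
    z ∉ spectrum ℂ T ∧ Metric.infDist z Ω * ‖resolvent T z‖ ≤ K

/-- The Kreiss constant `K_T(Ω)` is finite if and only if `σ(T) ⊆ closure Ω` and the resolvent
estimate `‖(z − T)⁻¹‖ ≤ C / dist(z, Ω)` holds on some open neighborhood of `closure Ω`. -/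
theorem kreissFinite_iff_resolvent_estimate_on_neighborhood
    {X : Type*} [NormedAddCommGroup X] [NormedSpace ℂ X] [CompleteSpace X] [Nontrivial X]
    (T : X →L[ℂ] X) (Ω : Set ℂ) (hne : Ω.Nonempty) (hcl : closure Ω ≠ Set.univ) :
    KreissFinite T Ω ↔
      (spectrum ℂ T ⊆ closure Ω ∧
        ∃ U : Set ℂ, IsOpen U ∧ closure Ω ⊆ U ∧
          ∃ C : ℝ, 0 ≤ C ∧ ∀ z ∈ U, z ∉ closure Ω →
            z ∉ spectrum ℂ T ∧ ‖resolvent T z‖ ≤ C / infDist z Ω) := by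
  constructor
  · rintro ⟨K, hK⟩
    refine ⟨fun z hz => by_contra fun h => (hK z h).1 hz, Set.univ, isOpen_univ,
      Set.subset_univ _, max K 0, le_max_right _ _, fun z _ hz => ⟨(hK z hz).1, ?_⟩⟩
    have hpos : 0 < infDist z Ω := (infDist_pos_iff_notMem_closure hne).1 hz
    rw [le_div_iff₀ hpos, mul_comm]
    exact (hK z hz).2.trans (le_max_left _ _)
  · rintro ⟨hσ, U, hU, hΩU, C, hC, hUC⟩
    obtain ⟨w, hw⟩ := hne
    obtain ⟨c, hc0, hc⟩ := (spectrum.resolvent_isBigO_inv (𝕜 := ℂ) T).exists_pos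
    rw [Asymptotics.isBigOWith_iff] at hc
    obtain ⟨R, -, hR⟩ := (Metric.hasBasis_cobounded_compl_closedBall (0 : ℂ)).eventually_iff.1 hc
    have hcomp : IsCompact (closedBall (0 : ℂ) (max R 1) ∩ Uᶜ) :=
      (isCompact_closedBall _ _).inter_right hU.isClosed_compl
    have hcont : ContinuousOn (fun z => infDist z Ω * ‖resolvent T z‖)
        (closedBall (0 : ℂ) (max R 1) ∩ Uᶜ) := by
      intro z hz
      have hzσ : z ∈ resolventSet ℂ T := by
        by_contra h
        exact hz.2 (hΩU (hσ h))
      exact ((continuous_infDist_pt Ω).continuousAt.mul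
        (spectrum.hasDerivAt_resolvent_const_left hzσ).continuousAt.norm).continuousWithinAt
    obtain ⟨M, hM⟩ := hcomp.bddAbove_image hcont
    refine ⟨max C (max M (c * (1 + ‖w‖))), fun z hz => ⟨fun h => hz (hσ h), ?_⟩⟩
    by_cases hzU : z ∈ U
    · have hpos : 0 < infDist z Ω := (infDist_pos_iff_notMem_closure ⟨w, hw⟩).1 hz
      have h := (hUC z hzU hz).2
      rw [le_div_iff₀ hpos, mul_comm] at h
      exact h.trans (le_max_left _ _)
    refine le_trans ?_ (le_max_right _ _)
    by_cases hzR : z ∈ closedBall (0 : ℂ) (max R 1)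
    · exact (hM ⟨z, ⟨hzR, hzU⟩, rfl⟩).trans (le_max_left _ _)
    · refine le_trans ?_ (le_max_right _ _)
      rw [mem_closedBall_zero_iff, not_le, max_lt_iff] at hzR
      have h1 : ‖resolvent T z‖ ≤ c * ‖z⁻¹‖ := hR (by simpa using hzR.1)
      have h2 : infDist z Ω ≤ ‖z‖ + ‖w‖ :=
        (infDist_le_dist_of_mem hw).trans (by rw [dist_eq_norm]; exact norm_sub_le _ _)
      have hz0 : 0 < ‖z‖ := by linarith [hzR.2]
      calc infDist z Ω * ‖resolvent T z‖ ≤ (‖z‖ + ‖w‖) * (c * ‖z⁻¹‖) := by gcongr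
        _ = c * (1 + ‖w‖ / ‖z‖) := by rw [norm_inv]; field_simp
        _ ≤ c * (1 + ‖w‖) := by
          gcongr
          exact div_le_self (norm_nonneg _) hzR.2.le
end
end

section
/- Let a, b, c, d ∈ ℂ with ad − bc ≠ 0, and let φ(z) = (az + b)/(cz + d). Let X be a nonzero complex Banach space and T a bounded linear operator on X such that cT + dI is invertible, and set φ(T) = (aT + bI)(cT + dI)^{-1}. Let D ⊆ ℂ be an open disk or the complement of a closed disk, with −d/c ∉ ∂D in case c ≠ 0, and set φ(D) = {φ(z) : z ∈ D, cz + d ≠ 0}. Assume that φ(D) is again an open disk or the complement of a closed disk (i.e., φ(D) is not a half-plane). If the Kreiss constant K_T(D) is finite, then the Kreiss constant K_{φ(T)}(φ(D)) is finite as well. -/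
open Metric

noncomputable section

/-- A Riemann sphere disk in `ℂ` is either an open disk or the complement of a closed
disk. -/
def IsRiemannSphereDisk (D : Set ℂ) : Prop :=
  ∃ (c : ℂ) (r : ℝ), 0 < r ∧ (D = Metric.ball c r ∨ D = (Metric.closedBall c r)ᶜ)

/-- Invariance of the finiteness of the Kreiss constant under Möbius transformations:
if `φ(z) = (az + b)/(cz + d)` with `ad − bc ≠ 0`, `cT + dI` is invertible, `D` is a Riemann
sphere disk avoiding the pole of `φ` on its boundary, and `φ(D)` is again a Riemann sphere
disk (i.e. not a half-plane), then finiteness of `K_T(D)` implies finiteness of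
`K_{φ(T)}(φ(D))`. -/
theorem kreissFinite_moebius
    {X : Type*} [NormedAddCommGroup X] [NormedSpace ℂ X] [CompleteSpace X] [Nontrivial X]
    (a b c d : ℂ) (hdet : a * d - b * c ≠ 0)
    (T : X →L[ℂ] X) (hinv : IsUnit (c • T + d • (1 : X →L[ℂ] X)))
    (D : Set ℂ) (hD : IsRiemannSphereDisk D)
    (hpole : c ≠ 0 → -d / c ∉ frontier D)
    (hφD : IsRiemannSphereDisk ((fun z : ℂ => (a * z + b) / (c * z + d)) ''
      {z ∈ D | c * z + d ≠ 0}))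
    (hK : KreissFinite T D) :
    KreissFinite ((a • T + b • (1 : X →L[ℂ] X)) * Ring.inverse (c • T + d • (1 : X →L[ℂ] X)))
      ((fun z : ℂ => (a * z + b) / (c * z + d)) '' {z ∈ D | c * z + d ≠ 0}) := by
  obtain ⟨K, hK⟩ := hK
  set U : X →L[ℂ] X := c • T + d • (1 : X →L[ℂ] X) with hU
  set S : X →L[ℂ] X := Ring.inverse U with hS
  have hUS : U * S = 1 := Ring.mul_inverse_cancel _ hinv
  have hSU : S * U = 1 := Ring.inverse_mul_cancel _ hinv
  set A : X →L[ℂ] X := (a • T + b • (1 : X →L[ℂ] X)) * S with hA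
  set φ : ℂ → ℂ := fun z : ℂ => (a * z + b) / (c * z + d) with hφ
  set Ω : Set ℂ := φ '' {z ∈ D | c * z + d ≠ 0} with hΩ
  have hφz : ∀ z, φ z = (a * z + b) / (c * z + d) := fun z => rfl
  -- the denominator is bounded below on the frontier
  obtain ⟨δ, hδ, hδf⟩ : ∃ δ : ℝ, 0 < δ ∧ ∀ z ∈ frontier D, δ ≤ ‖c * z + d‖ := by
    by_cases hc : c = 0
    · subst hc
      have hd : d ≠ 0 := by
        rintro rfl
        simp at hdet
      exact ⟨‖d‖, norm_pos_iff.2 hd, fun z _ => by simp⟩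
    · have h1 := hpole hc
      have ho : IsOpen (frontier D)ᶜ := isClosed_frontier.isOpen_compl
      obtain ⟨ε, hε, hb⟩ := Metric.isOpen_iff.1 ho _ h1
      refine ⟨‖c‖ * ε, mul_pos (norm_pos_iff.2 hc) hε, fun z hz => ?_⟩
      have h2 : ε ≤ ‖z - (-d / c)‖ := by
        by_contra h
        exact hb (by rw [Metric.mem_ball, dist_eq_norm]; exact not_le.1 h) hz
      have h3 : c * z + d = c * (z - (-d / c)) := by field_simp; ring
      rw [h3, norm_mul]
      exact mul_le_mul_of_nonneg_left h2 (norm_nonneg _)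
  -- images of closure points
  have hcl : ∀ z ∈ closure D, c * z + d ≠ 0 → φ z ∈ closure Ω := by
    intro z hz hne
    have hopen : IsOpen {z : ℂ | c * z + d ≠ 0} :=
      isOpen_ne_fun (by fun_prop) (by fun_prop)
    have hz' : z ∈ closure {z ∈ D | c * z + d ≠ 0} := by
      have := hopen.inter_closure (t := D) ⟨hne, hz⟩
      rwa [Set.inter_comm] at this
    have hcont : ContinuousAt φ z := by
      have h1 : ContinuousAt (fun z : ℂ => a * z + b) z := by fun_prop
      have h2 : ContinuousAt (fun z : ℂ => c * z + d) z := by fun_prop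
      exact h1.div h2 hne
    exact hcont.continuousWithinAt.mem_closure_image hz'
  have hwA : ∀ w : ℂ, w • (1 : X →L[ℂ] X) - A
      = ((w * c - a) • T + (w * d - b) • (1 : X →L[ℂ] X)) * S := by
    intro w
    have : (w * c - a) • T + (w * d - b) • (1 : X →L[ℂ] X)
        = w • U - (a • T + b • (1 : X →L[ℂ] X)) := by
      rw [hU]; module
    rw [this, sub_mul, smul_mul_assoc, hUS]
  refine ⟨max (Metric.infDist (a / c) Ω * ‖resolvent A (a / c)‖)
    (‖U‖ * K / δ), fun w hw => ?_⟩
  by_cases he : a - w * c = 0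
  · have hc : c ≠ 0 := by
      rintro rfl
      simp at he
      simp [he] at hdet
    have hwe : w = a / c := by
      field_simp
      linear_combination -he
    refine ⟨?_, by rw [← hwe]; exact le_max_left _ _⟩
    have hne : w * d - b ≠ 0 := by
      intro h
      apply hdet
      linear_combination d * he + c * h
    rw [spectrum.notMem_iff, Algebra.algebraMap_eq_smul_one, hwA w]
    have h0 : w * c - a = 0 := by linear_combination -he
    rw [h0, zero_smul, zero_add, smul_mul_assoc, one_mul]
    refine ⟨⟨(w * d - b) • S, (w * d - b)⁻¹ • U, ?_, ?_⟩, rfl⟩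
    · rw [smul_mul_smul_comm, hSU, mul_inv_cancel₀ hne, one_smul]
    · rw [smul_mul_smul_comm, hUS, inv_mul_cancel₀ hne, one_smul]
  · set e := a - w * c with hedef
    set z := (w * d - b) / e with hz
    have hze : z * e = w * d - b := div_mul_cancel₀ _ he
    have hzden : (c * z + d) * e = a * d - b * c := by
      linear_combination c * hze + d * hedef
    have hcz : c * z + d ≠ 0 := by
      intro h
      rw [h, zero_mul] at hzden
      exact hdet hzden.symm
    have hφw : φ z = w := by
      rw [hφz, div_eq_iff hcz]
      linear_combination hze + z * hedef
    have hzD : z ∉ closure D := fun h => hw (hφw ▸ hcl z h hcz)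
    obtain ⟨hspec, hbd⟩ := hK z hzD
    have hu : IsUnit (z • (1 : X →L[ℂ] X) - T) := by
      rwa [spectrum.notMem_iff, Algebra.algebraMap_eq_smul_one] at hspec
    set R := resolvent T z with hR
    have hR' : R = Ring.inverse (z • (1 : X →L[ℂ] X) - T) := by
      rw [hR, resolvent, Algebra.algebraMap_eq_smul_one]
    have h1 : (z • (1 : X →L[ℂ] X) - T) * R = 1 := by
      rw [hR']; exact Ring.mul_inverse_cancel _ hu
    have h2 : R * (z • (1 : X →L[ℂ] X) - T) = 1 := by
      rw [hR']; exact Ring.inverse_mul_cancel _ hu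
    have hM : w • (1 : X →L[ℂ] X) - A = e • ((z • (1 : X →L[ℂ] X) - T) * S) := by
      rw [hwA, ← smul_mul_assoc]
      congr 1
      rw [← hze, hedef]
      module
    have h3 : (w • (1 : X →L[ℂ] X) - A) * (e⁻¹ • (U * R)) = 1 := by
      rw [hM, smul_mul_smul_comm, mul_inv_cancel₀ he, one_smul, mul_assoc, ← mul_assoc S,
        hSU, one_mul, h1]
    have h4 : (e⁻¹ • (U * R)) * (w • (1 : X →L[ℂ] X) - A) = 1 := by
      rw [hM, smul_mul_smul_comm, inv_mul_cancel₀ he, one_smul, mul_assoc, ← mul_assoc R,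
        h2, one_mul, hUS]
    have hres : resolvent A w = e⁻¹ • (U * R) := by
      rw [resolvent, Algebra.algebraMap_eq_smul_one]
      exact Ring.inverse_unit ⟨_, _, h3, h4⟩
    refine ⟨?_, le_trans ?_ (le_max_right _ _)⟩
    · rw [spectrum.notMem_iff, Algebra.algebraMap_eq_smul_one]
      exact ⟨⟨_, _, h3, h4⟩, rfl⟩
    have hDne : D.Nonempty := by
      obtain ⟨x, r, hr, h | h⟩ := hD
      · rw [h]; exact ⟨x, Metric.mem_ball_self hr⟩
      · rw [h]
        refine ⟨x + (r + 1 : ℝ), ?_⟩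
        simp only [Set.mem_compl_iff, Metric.mem_closedBall, dist_eq_norm, add_sub_cancel_left,
          Complex.norm_real, Real.norm_eq_abs, not_le]
        rw [abs_of_pos (by linarith)]
        linarith
    obtain ⟨z0, hz0, hdist⟩ := exists_mem_frontier_infDist_compl_eq_dist
      (s := (closure D)ᶜ) (x := z) hzD (by
        intro h
        obtain ⟨x, hx⟩ := hDne
        have : x ∈ (closure D)ᶜ := by rw [h]; trivial
        exact this (subset_closure hx))
    rw [compl_compl, Metric.infDist_closure] at hdist
    rw [frontier_compl] at hz0
    have hz0f : z0 ∈ frontier D := frontier_closure_subset hz0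
    have hδ0 := hδf z0 hz0f
    have hcz0 : c * z0 + d ≠ 0 := norm_pos_iff.1 (hδ.trans_le hδ0)
    have hw0 : φ z0 ∈ closure Ω := hcl z0 (frontier_subset_closure hz0f) hcz0
    have hdw : Metric.infDist w Ω ≤ ‖w - φ z0‖ := by
      rw [← Metric.infDist_closure, ← dist_eq_norm]
      exact Metric.infDist_le_dist_of_mem hw0
    have hdiff : w - φ z0 = e * (z - z0) / (c * z0 + d) := by
      rw [hφz, eq_div_iff hcz0, sub_mul, div_mul_cancel₀ _ hcz0]
      linear_combination -hze + z0 * hedef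
    have hepos : 0 < ‖e‖ := norm_pos_iff.2 he
    rw [dist_eq_norm] at hdist
    rw [hdist] at hbd
    rw [hdiff, norm_div, norm_mul] at hdw
    rw [hres, norm_smul, norm_inv]
    calc Metric.infDist w Ω * (‖e‖⁻¹ * ‖U * R‖)
        ≤ (‖e‖ * ‖z - z0‖ / δ) * (‖e‖⁻¹ * (‖U‖ * ‖R‖)) := by
          have h5 : ‖e‖ * ‖z - z0‖ / ‖c * z0 + d‖ ≤ ‖e‖ * ‖z - z0‖ / δ := by gcongr
          have h6 : ‖U * R‖ ≤ ‖U‖ * ‖R‖ := norm_mul_le _ _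
          have h7 := hdw.trans h5
          gcongr
      _ = ‖U‖ * (‖z - z0‖ * ‖R‖) / δ := by field_simp
      _ ≤ ‖U‖ * K / δ := by gcongr
end
end
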